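/- Let G be a minor-minimal enemy. Then for every edge uv ∈ E(G), the graph G/uv obtained from G by contracting the edge uv is not isomorphic to K_{2,2,2,2}. -/

import Mathlib

open SimpleGraph

/-- `K7vee` is the graph obtained from `K 7` by deleting two edges with a common end. -/
def K7vee : SimpleGraph (Fin 7) :=
  (completeGraph (Fin 7)).deleteEdges {s(0, 1), s(0, 2)}

/-- `K6vee` is the graph obtained from `K 6` by deleting two edges with a common end. -/
def K6vee : SimpleGraph (Fin 6) :=
  (completeGraph (Fin 6)).deleteEdges {s(0, 1), s(0, 2)}

/-- The complete multipartite graph with four parts of size two. -/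
def K2222 : SimpleGraph (Fin 4 × Fin 2) :=
  SimpleGraph.comap Prod.fst (completeGraph (Fin 4))

/-- `H` is a minor of `G`: there is a model of `H` in `G`, i.e. a family of pairwise disjoint
nonempty connected branch sets, one for each vertex of `H`, with edges of `G` between branch
sets corresponding to adjacent vertices of `H`. -/
def IsMinor {W V : Type} (H : SimpleGraph W) (G : SimpleGraph V) : Prop :=
  ∃ bag : W → Set V,
    (∀ w, (G.induce (bag w)).Connected) ∧
    (∀ w w', w ≠ w' → Disjoint (bag w) (bag w')) ∧
    (∀ w w', H.Adj w w' → ∃ u ∈ bag w, ∃ v ∈ bag w', G.Adj u v)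

/-- A graph is `k`-connected if it has more than `k` vertices and stays connected after
removing any set of fewer than `k` vertices. -/
def IsKConnected {V : Type} [Fintype V] (k : ℕ) (G : SimpleGraph V) : Prop :=
  k < Fintype.card V ∧ ∀ S : Set V, S.ncard < k → (G.induce (Sᶜ : Set V)).Connected

/-- A separation of `G`: `A ∪ B = V(G)` and no edge joins `A - B` to `B - A`. -/
def IsSeparation {V : Type} (G : SimpleGraph V) (A B : Set V) : Prop :=
  A ∪ B = Set.univ ∧ ∀ ⦃u v : V⦄, G.Adj u v → ¬(u ∈ A \ B ∧ v ∈ B \ A)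

/-- `(G, Z)` is internally `k`-connected: every separation `(A,B)` of `G` with `Z ⊆ A`
and `B - A ≠ ∅` has order at least `k`. -/
def InternallyConnected {V : Type} (G : SimpleGraph V) (Z : Set V) (k : ℕ) : Prop :=
  ∀ A B : Set V, IsSeparation G A B → Z ⊆ A → (B \ A).Nonempty →
    k ≤ (A ∩ B).ncard

/-- A `Z`-rooted `K₄`-model in `G`. -/
def HasRootedK4Model {V : Type} (G : SimpleGraph V) (Z : Set V) : Prop :=
  ∃ B : Fin 4 → Set V,
    (∀ i, (G.induce (B i)).Connected) ∧
    (∀ i j, i ≠ j → Disjoint (B i) (B j)) ∧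
    (∀ i, ∃! z : V, z ∈ Z ∧ z ∈ B i) ∧
    (∀ z ∈ Z, ∃ i, z ∈ B i) ∧
    (∀ i j, i ≠ j → ∃ u ∈ B i, ∃ v ∈ B j, G.Adj u v)

/-- A `Z`-rooted `K*₄,₂`-model in `G`. -/
def HasRootedK42starModel {V : Type} (G : SimpleGraph V) (Z : Set V) : Prop :=
  ∃ (B : Fin 4 → Set V) (C : Fin 2 → Set V),
    (∀ i, (G.induce (B i)).Connected) ∧
    (∀ j, (G.induce (C j)).Connected) ∧
    (∀ i j, i ≠ j → Disjoint (B i) (B j)) ∧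
    (∀ i j, i ≠ j → Disjoint (C i) (C j)) ∧
    (∀ i j, Disjoint (B i) (C j)) ∧
    (∀ i, ∃! z : V, z ∈ Z ∧ z ∈ B i) ∧
    (∀ z ∈ Z, ∃ i, z ∈ B i) ∧
    (∀ i j, ∃ u ∈ B i, ∃ v ∈ C j, G.Adj u v) ∧
    (∃ u ∈ C 0, ∃ v ∈ C 1, G.Adj u v)

/-- An enemy: a `4`-connected graph with `|E(G)| ≥ 4|V(G)| - 8`, with no `K7vee`-minor,
not isomorphic to `K_{2,2,2,2}`. -/
def Enemy {V : Type} [Fintype V] (G : SimpleGraph V) : Prop :=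
  IsKConnected 4 G ∧
    4 * (Fintype.card V : ℤ) - 8 ≤ (G.edgeSet.ncard : ℤ) ∧
    ¬ IsMinor K7vee G ∧
    IsEmpty (G ≃g K2222)

/-- A minor-minimal enemy: an enemy, no minor of which, other than itself, is an enemy. -/
def MinorMinimalEnemy {V : Type} [Fintype V] (G : SimpleGraph V) : Prop :=
  Enemy G ∧ ∀ (W : Type) [Fintype W] (H : SimpleGraph W),
    IsMinor H G → Enemy H → Nonempty (H ≃g G)

/-- The simple graph obtained from `G` by contracting the edge `uv`
(`v` is merged into `u`). -/
def contractEdge {V : Type} (G : SimpleGraph V) (u v : V) :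
    SimpleGraph {x : V // x ≠ v} :=
  SimpleGraph.fromRel (fun x y => G.Adj ↑x ↑y ∨ ((x : V) = u ∧ G.Adj v ↑y))

/-- A graph is `7`-contraction-critical if its chromatic number is `7` and
every minor of it, other than itself, has chromatic number less than `7`. -/
def ContractionCritical7 {V : Type} [Fintype V] (G : SimpleGraph V) : Prop :=
  G.chromaticNumber = 7 ∧
    ∀ (W : Type) [Fintype W] (H : SimpleGraph W),
      IsMinor H G → IsEmpty (H ≃g G) → H.chromaticNumber < 7

/-- A singleton or an edge of `G` is a connected branch set. -/
theorem induce_pair_connected_of_eq_or_adj {V : Type} (G : SimpleGraph V) {a b : V}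
    (h : a = b ∨ G.Adj a b) : (G.induce ({a, b} : Set V)).Connected := by
  rcases h with rfl | h
  · have : Subsingleton ({a, a} : Set V) := by simp
    have : Nonempty ({a, a} : Set V) := ⟨⟨a, by simp⟩⟩
    exact ⟨fun x y => Subsingleton.elim x y ▸ Reachable.refl _⟩
  · exact induce_pair_connected_of_adj h

/-- A `K7vee`-model with two branch sets of size two in a graph containing an octahedron
`b₁b₂`, `c₁c₂`, `d₁d₂` together with an apex `a` and an edge `uv`. -/
theorem isMinor_K7vee_of_adj {V : Type} (G : SimpleGraph V) {a u v b₁ b₂ c₁ c₂ d₁ d₂ : V}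
    (hnd : [a, u, v, b₁, b₂, c₁, c₂, d₁, d₂].Nodup) (huv : G.Adj u v)
    (ha : G.Adj a b₁ ∧ G.Adj a b₂ ∧ G.Adj a c₁ ∧ G.Adj a c₂ ∧ G.Adj a d₂)
    (hb₁ : G.Adj b₁ c₁ ∧ G.Adj b₁ c₂ ∧ G.Adj b₁ d₂)
    (hb₂ : G.Adj b₂ c₁ ∧ G.Adj b₂ c₂ ∧ G.Adj b₂ d₂)
    (hd : G.Adj c₁ d₁ ∧ G.Adj c₁ d₂ ∧ G.Adj c₂ d₁ ∧ G.Adj c₂ d₂)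
    (hv : G.Adj v b₁ ∧ G.Adj v b₂) (hu : G.Adj u b₁ ∧ G.Adj u c₂)
    (hucd : G.Adj u c₁ ∨ G.Adj u d₁) : IsMinor K7vee G := by
  obtain ⟨ha1, ha2, ha3, ha4, ha5⟩ := ha
  obtain ⟨hb1, hb2, hb3⟩ := hb₁
  obtain ⟨hb4, hb5, hb6⟩ := hb₂
  obtain ⟨hd1, hd2, hd3, hd4⟩ := hd
  obtain ⟨hv1, hv2⟩ := hv
  obtain ⟨hu1, hu2⟩ := hu
  have key : ∀ w w' : Fin 7, w < w' → K7vee.Adj w w' →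
      ∃ x ∈ (![{u, u}, {a, a}, {d₂, d₂}, {b₁, b₁}, {c₂, c₂}, {v, b₂}, {c₁, d₁}] :
        Fin 7 → Set V) w,
      ∃ y ∈ (![{u, u}, {a, a}, {d₂, d₂}, {b₁, b₁}, {c₂, c₂}, {v, b₂}, {c₁, d₁}] :
        Fin 7 → Set V) w', G.Adj x y := by
    intro w w' hlt hadj
    fin_cases w <;> fin_cases w' <;>
      first
      | exact absurd hlt (by decide)
      | (simp [K7vee] at hadj; done)
      | simp_all [G.adj_comm]
  refine ⟨![{u, u}, {a, a}, {d₂, d₂}, {b₁, b₁}, {c₂, c₂}, {v, b₂}, {c₁, d₁}], ?_, ?_, ?_⟩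
  · intro w
    fin_cases w <;> apply induce_pair_connected_of_eq_or_adj <;> simp [*]
  · intro w w' hne
    rw [Set.disjoint_left]
    simp only [List.nodup_cons, List.mem_cons, not_or] at hnd
    fin_cases w <;> fin_cases w' <;> simp at hne ⊢ <;> grind
  · intro w w' hadj
    rcases lt_or_gt_of_ne hadj.ne with hlt | hlt
    · exact key w w' hlt hadj
    · obtain ⟨x, hx, y, hy, hxy⟩ := key w' w hlt hadj.symm
      exact ⟨y, hy, x, hx, hxy.symm⟩

/-- A graph on nine vertices that contracts to `K2222` along an edge `uv`. The contracted vertex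
is `(0, 0)`, and `p` names the eight vertices other than `v`. -/
structure IsSplitK2222 {V : Type} (G : SimpleGraph V) (u v : V) (p : Fin 4 × Fin 2 → V) :
    Prop where
  injective : Function.Injective p
  exists_eq : ∀ x, x ≠ v → ∃ i, p i = x
  ne : ∀ i, p i ≠ v
  zero : p (0, 0) = u
  adj_uv : G.Adj u v
  adj_iff : ∀ i j, i ≠ (0, 0) → j ≠ (0, 0) → (G.Adj (p i) (p j) ↔ i.1 ≠ j.1)
  adj_or_iff : ∀ i, i ≠ (0, 0) → (G.Adj u (p i) ∨ G.Adj v (p i) ↔ i.1 ≠ 0)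

theorem exists_isSplitK2222 {V : Type} (G : SimpleGraph V) {u v : V} (huv : G.Adj u v)
    (φ : contractEdge G u v ≃g K2222) : ∃ p, IsSplitK2222 G u v p := by
  obtain ⟨ψ, hψ⟩ : ∃ ψ : contractEdge G u v ≃g K2222, ψ ⟨u, huv.ne⟩ = (0, 0) := by
    let σ : K2222 ≃g K2222 :=
      { toEquiv := Equiv.prodCongr (Equiv.swap (φ ⟨u, huv.ne⟩).1 0)
          (Equiv.swap (φ ⟨u, huv.ne⟩).2 0)
        map_rel_iff' := by simp [K2222] }
    exact ⟨φ.trans σ, Prod.ext (Equiv.swap_apply_left _ _) (Equiv.swap_apply_left _ _)⟩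
  have hval : ∀ i, ((ψ.symm i : {x : V // x ≠ v}) : V) = u ↔ i = (0, 0) := fun i => by
    rw [← hψ, ← show ψ.symm i = ⟨u, huv.ne⟩ ↔ i = ψ ⟨u, huv.ne⟩ from
      ψ.toEquiv.symm_apply_eq, Subtype.ext_iff]
  have hadj : ∀ i j, (contractEdge G u v).Adj (ψ.symm i) (ψ.symm j) ↔ i.1 ≠ j.1 := fun i j => by
    rw [ψ.symm.map_adj_iff]; simp [K2222]
  refine ⟨fun i => ψ.symm i, Subtype.val_injective.comp ψ.symm.injective,
    fun x hx => ⟨ψ ⟨x, hx⟩, by simp⟩, fun i => (ψ.symm i).2, (hval _).2 rfl, huv, ?_, ?_⟩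
  · intro i j hi hj
    rw [← hadj, show (contractEdge G u v).Adj _ _ ↔ _ from fromRel_adj _ _ _]
    simp only [hval, hi, hj, false_and, or_false, G.adj_comm (ψ.symm j).1, or_self]
    exact ⟨fun h => ⟨fun e => h.ne (congrArg _ e), h⟩, fun h => h.2⟩
  · intro i hi
    have h0 := hadj i (0, 0)
    rw [show (contractEdge G u v).Adj _ _ ↔ _ from fromRel_adj _ _ _] at h0
    simp only [hval, hi, false_and, or_false, true_and, (hval (0, 0)).2 rfl,
      G.adj_comm _ u] at h0
    rw [← h0]
    have : ψ.symm i ≠ ψ.symm (0, 0) := fun e => hi (ψ.symm.injective e)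
    tauto

namespace IsSplitK2222

variable {V : Type} {G : SimpleGraph V} {u v : V} {p : Fin 4 × Fin 2 → V}

/-- The edge count forces `u` and `v` to have at least three common neighbours. -/
theorem three_le_card_common [Fintype V] (hp : IsSplitK2222 G u v p)
    (hE : 4 * (Fintype.card V : ℤ) - 8 ≤ (G.edgeSet.ncard : ℤ)) :
    ∃ C : Finset (Fin 3 × Fin 2), 3 ≤ C.card ∧
      ∀ x ∈ C, G.Adj u (p (x.1.succ, x.2)) ∧ G.Adj v (p (x.1.succ, x.2)) := by
  classical
  let q : Option (Fin 4 × Fin 2) → V := fun o => o.elim v p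
  have hq : Function.Bijective q := by
    constructor
    · rintro (_ | i) (_ | j) h
      · rfl
      · exact absurd h.symm (hp.ne j)
      · exact absurd h (hp.ne i)
      · exact congrArg some (hp.injective h)
    · intro x
      by_cases hx : x = v
      · exact ⟨none, hx.symm⟩
      · obtain ⟨i, hi⟩ := hp.exists_eq x hx
        exact ⟨some i, hi⟩
  have hcard : Fintype.card V = 9 := by
    rw [← Fintype.card_of_bijective hq]; simp
  obtain ⟨χ, hχ⟩ : ∃ χ : V → V → ℕ, ∀ x y, χ x y = if G.Adj x y then 1 else 0 :=
    ⟨_, fun _ _ => rfl⟩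
  have hsum : ∑ x, ∑ y, χ (q x) (q y) = 2 * G.edgeSet.ncard := by
    rw [← coe_edgeFinset, Set.ncard_coe_finset, ← sum_degrees_eq_twice_card_edges,
      ← hq.sum_comp]
    refine Finset.sum_congr rfl fun x _ => ?_
    rw [← card_neighborFinset_eq_degree, neighborFinset_eq_filter, Finset.card_filter,
      ← hq.sum_comp]
    simp only [hχ]
  refine ⟨Finset.univ.filter fun x =>
    G.Adj u (p (x.1.succ, x.2)) ∧ G.Adj v (p (x.1.succ, x.2)), ?_, by simp⟩
  have hor : ∀ (i : Fin 3) (j : Fin 2), χ u (p (i.succ, j)) + χ v (p (i.succ, j)) =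
      1 + if G.Adj u (p (i.succ, j)) ∧ G.Adj v (p (i.succ, j)) then 1 else 0 := by
    intro i j
    have := (hp.adj_or_iff (i.succ, j) (by simp)).2 (by simp)
    rw [hχ, hχ]
    split_ifs <;> simp_all
  have h0 : ∀ w, w = u ∨ w = v → χ w (p (0, 1)) = 0 := by
    have := hp.adj_or_iff (0, 1) (by simp)
    rintro w (rfl | rfl) <;> simp_all
  have hcomm : ∀ x y, χ x y = χ y x := fun x y => by simp only [hχ, G.adj_comm]
  have huv : χ u v = 1 := by simp [hχ, hp.adj_uv]
  have hself : ∀ x, χ x x = 0 := by simp [hχ]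
  have hpp : ∀ i j, i ≠ (0, 0) → j ≠ (0, 0) → χ (p i) (p j) = if i.1 ≠ j.1 then 1 else 0 :=
    fun i j hi hj => by simp only [hχ, hp.adj_iff i j hi hj]
  simp only [Finset.card_filter, Fintype.sum_prod_type]
  simp [Fintype.sum_option, Fintype.sum_prod_type, Fin.sum_univ_succ, q, hp.zero, hcomm (p _) u,
    hcomm (p _) v, hcomm v u, huv, h0, hself, hpp] at hsum
  simp [-Finset.sum_boole, Fin.forall_fin_succ] at hor
  simp [-Finset.sum_boole, Fin.sum_univ_succ]
  omega

/-- The situation is symmetric in `u` and `v`, so `s` and `t` stand for them in either order. -/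
theorem isMinor_K7vee_of_adj (hp : IsSplitK2222 G u v p) {s t : V}
    (hst : s = u ∧ t = v ∨ s = v ∧ t = u) {i k l : Fin 3} (hik : i ≠ k) (hil : i ≠ l)
    (hkl : k ≠ l) {j m n : Fin 2} (ht : G.Adj t (p (i.succ, j)) ∧ G.Adj t (p (i.succ, j + 1)))
    (hs : G.Adj s (p (i.succ, j)) ∧ G.Adj s (p (k.succ, m)))
    (hs' : G.Adj s (p (k.succ, m + 1)) ∨ G.Adj s (p (l.succ, n))) : IsMinor K7vee G := by
  have hadj : G.Adj s t := by
    rcases hst with ⟨rfl, rfl⟩ | ⟨rfl, rfl⟩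
    exacts [hp.adj_uv, hp.adj_uv.symm]
  have hne : ∀ x, x ≠ (0, 0) → p x ≠ s ∧ p x ≠ t := by
    intro x hx
    have h1 : p x ≠ u := fun e => hx (hp.injective (e.trans hp.zero.symm))
    have h2 := hp.ne x
    rcases hst with ⟨rfl, rfl⟩ | ⟨rfl, rfl⟩
    exacts [⟨h1, h2⟩, ⟨h2, h1⟩]
  refine _root_.isMinor_K7vee_of_adj G (a := p (0, 1)) (d₂ := p (l.succ, n + 1)) ?_ hadj
    ?_ ?_ ?_ ?_ ht hs hs'
  · have hj : ∀ j : Fin 2, j ≠ j + 1 := by decide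
    simp [hp.injective.eq_iff, hne, hik, hil, hkl, hadj.ne, hj, (hne _ _).1.symm,
      (hne _ _).2.symm, (Fin.succ_ne_zero _).symm]
  all_goals simp [hp.adj_iff, hik, hil, hkl, (Fin.succ_ne_zero _).symm]

/-- If `u` and `v` have at least three common neighbours, there is a `K7vee`-minor. -/
theorem isMinor_K7vee (hp : IsSplitK2222 G u v p) {C : Finset (Fin 3 × Fin 2)}
    (hC : 3 ≤ C.card)
    (hadj : ∀ x ∈ C, G.Adj u (p (x.1.succ, x.2)) ∧ G.Adj v (p (x.1.succ, x.2))) :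
    IsMinor K7vee G := by
  have hor : ∀ (i : Fin 3) (j : Fin 2), G.Adj u (p (i.succ, j)) ∨ G.Adj v (p (i.succ, j)) :=
    fun i j => (hp.adj_or_iff (i.succ, j) (by simp)).2 (by simp)
  have hcases : ∀ C : Finset (Fin 3 × Fin 2), 3 ≤ C.card → (∀ i, ∃ j, (i, j) ∈ C) ∨
      ∃ i k l, i ≠ k ∧ i ≠ l ∧ k ≠ l ∧ (∀ j, (i, j) ∈ C) ∧ ∃ j, (k, j) ∈ C := by
    set_option synthInstance.maxSize 1000 in decide
  obtain h | ⟨i, k, l, hik, hil, hkl, hi, m, hk⟩ := hcases C hC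
  · choose j hj using fun i => h i
    have hc := fun i => hadj _ (hj i)
    rcases hor 0 (j 0 + 1) with h0 | h0
    · exact hp.isMinor_K7vee_of_adj (.inr ⟨rfl, rfl⟩) (show (0 : Fin 3) ≠ 1 by decide)
        (show (0 : Fin 3) ≠ 2 by decide) (by decide) ⟨(hc 0).1, h0⟩ ⟨(hc 0).2, (hc 1).2⟩
        (.inr (hc 2).2)
    · exact hp.isMinor_K7vee_of_adj (.inl ⟨rfl, rfl⟩) (show (0 : Fin 3) ≠ 1 by decide)
        (show (0 : Fin 3) ≠ 2 by decide) (by decide) ⟨(hc 0).2, h0⟩ ⟨(hc 0).1, (hc 1).1⟩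
        (.inr (hc 2).1)
  · have hc := fun j => hadj _ (hi j)
    have hm := hadj _ hk
    rcases hor k (m + 1) with h0 | h0
    · exact hp.isMinor_K7vee_of_adj (n := 0) (.inl ⟨rfl, rfl⟩) hik hil hkl
        ⟨(hc 0).2, (hc 1).2⟩ ⟨(hc 0).1, hm.1⟩ (.inl h0)
    · exact hp.isMinor_K7vee_of_adj (n := 0) (.inr ⟨rfl, rfl⟩) hik hil hkl
        ⟨(hc 0).1, (hc 1).1⟩ ⟨(hc 0).2, hm.2⟩ (.inl h0)

end IsSplitK2222

/-- for a minor-minimal enemy `G` and an edge `uv`, the contraction `G/uv`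
is not isomorphic to `K_{2,2,2,2}`. -/
theorem statement_9 (V : Type) [Fintype V] (G : SimpleGraph V)
    (h : MinorMinimalEnemy G) (u v : V) (huv : G.Adj u v) :
    IsEmpty (contractEdge G u v ≃g K2222) := by
  refine ⟨fun φ => ?_⟩
  obtain ⟨p, hp⟩ := exists_isSplitK2222 G huv φ
  obtain ⟨C, hC, hadj⟩ := hp.three_le_card_common h.1.2.1
  exact h.1.2.2.1 (hp.isMinor_K7vee hC hadj)
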